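/- Let p, m, n be positive integers with m + n ≤ p. In the polynomial ring over ℂ in the variables a_{k,i} (1 ≤ k ≤ p, 1 ≤ i ≤ m) and b_{k,j} (1 ≤ k ≤ p, 1 ≤ j ≤ n), let J⁺ be the ideal generated by the mn polynomials ∑_{k=1}^p a_{k,i} b_{k,j} for 1 ≤ i ≤ m, 1 ≤ j ≤ n. Then J⁺ is a prime ideal, the quotient ring is an integrally closed integral domain, and its Krull dimension equals p(m+n) − mn. (That is, the null cone {(A,B) ∈ M_{p,m}(ℂ) × M_{p,n}(ℂ) : AᵀB = 0} is an irreducible normal variety which is a set-theoretic complete intersection of codimension mn.) -/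

import Mathlib

open MvPolynomial

/-- The ideal of the null cone `{(A,B) ∈ M_{p,m}(ℂ) × M_{p,n}(ℂ) : AᵀB = 0}`,
generated by the `mn` bilinear invariants `∑_k a_{k,i} b_{k,j}`. -/
noncomputable def nullConeIdealU (p m n : ℕ) :
    Ideal (MvPolynomial ((Fin p × Fin m) ⊕ (Fin p × Fin n)) ℂ) :=
  Ideal.span
    {f | ∃ (i : Fin m) (j : Fin n),
      f = ∑ k : Fin p, X (Sum.inl (k, i)) * X (Sum.inr (k, j))}

section CoprimeLeadingTerms

variable {σ κ R : Type*} [CommRing R]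

/-- A nonzero monomial divides a given monomial to a largest power. -/
theorem exists_forall_nsmul_le_iff {E : σ →₀ ℕ} (hE : E ≠ 0) (s : σ →₀ ℕ) :
    ∃ e : ℕ, ∀ k : ℕ, k • E ≤ s ↔ k ≤ e := by
  classical
  obtain ⟨x, hx⟩ := Finsupp.ne_iff.mp hE
  have hx : 1 ≤ E x := Nat.one_le_iff_ne_zero.mpr hx
  have hb : ∀ k : ℕ, k • E ≤ s → k ≤ s x := fun k hk => by
    have := hk x
    simp only [Finsupp.smul_apply, smul_eq_mul] at this
    nlinarith
  refine ⟨Nat.findGreatest (fun k => k • E ≤ s) (s x), fun k => ⟨fun hk =>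
    Nat.le_findGreatest (hb k hk) hk, fun hk => ?_⟩⟩
  have h0 : (fun k : ℕ => k • E ≤ s) 0 := by simp
  have h1 := Nat.findGreatest_spec (P := fun k : ℕ => k • E ≤ s) (Nat.zero_le (s x)) h0
  exact (nsmul_le_nsmul_left zero_le hk).trans h1

/-- `g` is the monic monomial `s` up to terms of smaller weight. -/
def HasLeadingMonomial (w : σ → ℕ) (g : MvPolynomial σ R) (s : σ →₀ ℕ) : Prop :=
  ∀ t ∈ (g - monomial s 1).support, Finsupp.weight w t < Finsupp.weight w s

theorem hasLeadingMonomial_monomial (w : σ → ℕ) (s : σ →₀ ℕ) :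
    HasLeadingMonomial w (monomial s (1 : R)) s := by
  simp [HasLeadingMonomial]

theorem HasLeadingMonomial.weight_le {w : σ → ℕ} {g : MvPolynomial σ R} {s t : σ →₀ ℕ}
    (h : HasLeadingMonomial w g s) (ht : t ∈ g.support) :
    Finsupp.weight w t ≤ Finsupp.weight w s := by
  classical
  by_cases hts : t = s
  · rw [hts]
  · refine (h t ?_).le
    rw [mem_support_iff] at ht ⊢
    rwa [coeff_sub, coeff_monomial, if_neg (Ne.symm hts), sub_zero]

theorem HasLeadingMonomial.mul {w : σ → ℕ} {g h : MvPolynomial σ R} {s t : σ →₀ ℕ}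
    (hg : HasLeadingMonomial w g s) (hh : HasLeadingMonomial w h t) :
    HasLeadingMonomial w (g * h) (s + t) := by
  classical
  intro u hu
  have e : g * h - monomial (s + t) 1 =
      (g - monomial s 1) * h + monomial s 1 * (h - monomial t 1) := by
    rw [sub_mul, mul_sub, monomial_mul, one_mul]; ring
  rw [e] at hu
  rw [map_add]
  rcases Finset.mem_union.mp (support_add hu) with hu | hu
  · obtain ⟨a, ha, b, hb, rfl⟩ := Finset.mem_add.mp (support_mul _ _ hu)
    rw [map_add]
    exact add_lt_add_of_lt_of_le (hg a ha) (hh.weight_le hb)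
  · obtain ⟨a, ha, b, hb, rfl⟩ := Finset.mem_add.mp (support_mul _ _ hu)
    rw [map_add]
    exact add_lt_add_of_le_of_lt ((hasLeadingMonomial_monomial w s).weight_le ha) (hh b hb)

theorem HasLeadingMonomial.pow {w : σ → ℕ} {g : MvPolynomial σ R} {s : σ →₀ ℕ}
    (hg : HasLeadingMonomial w g s) (k : ℕ) : HasLeadingMonomial w (g ^ k) (k • s) := by
  induction k with
  | zero => simpa using hasLeadingMonomial_monomial w (0 : σ →₀ ℕ)
  | succ k ih => rw [pow_succ, succ_nsmul]; exact ih.mul hg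

theorem HasLeadingMonomial.prod {w : σ → ℕ} {g : κ → MvPolynomial σ R} {s : κ → σ →₀ ℕ}
    (hg : ∀ c, HasLeadingMonomial w (g c) (s c)) (A : Finset κ) :
    HasLeadingMonomial w (∏ c ∈ A, g c) (∑ c ∈ A, s c) := by
  classical
  induction A using Finset.induction_on with
  | empty => simpa using hasLeadingMonomial_monomial w (0 : σ →₀ ℕ)
  | insert a A ha ih => rw [Finset.prod_insert ha, Finset.sum_insert ha]; exact (hg a).mul ih

/-- A linear endomorphism sending every monomial to a polynomial with that monomial as its leading
monomial is bijective. -/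
theorem bijective_of_hasLeadingMonomial (w : σ → ℕ)
    (Φ : MvPolynomial σ R →ₗ[R] MvPolynomial σ R)
    (hΦ : ∀ s, HasLeadingMonomial w (Φ (monomial s 1)) s) : Function.Bijective Φ := by
  classical
  have hsum : ∀ h : MvPolynomial σ R, h = ∑ s ∈ h.support, coeff s h • monomial s (1 : R) :=
    fun h => by
      conv_lhs => rw [h.as_sum]
      exact Finset.sum_congr rfl fun s _ => by rw [smul_monomial, smul_eq_mul, mul_one]
  constructor
  · rw [injective_iff_map_eq_zero]
    intro h h0
    by_contra hne
    obtain ⟨s, hs, hmax⟩ := h.support.exists_max_image (Finsupp.weight w)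
      (support_nonempty.mpr hne)
    have key : coeff s (Φ h) = coeff s h := by
      conv_lhs => rw [hsum h]
      rw [map_sum, coeff_sum, Finset.sum_eq_single_of_mem s hs]
      · rw [map_smul, coeff_smul]
        have : s ∉ (Φ (monomial s 1) - monomial s 1).support := fun hmem =>
          lt_irrefl _ (hΦ s s hmem)
        rw [notMem_support_iff, coeff_sub, coeff_monomial, if_pos rfl, sub_eq_zero] at this
        rw [this, smul_eq_mul, mul_one]
      · intro t ht hts
        rw [map_smul, coeff_smul]
        have : s ∉ (Φ (monomial t 1) - monomial t 1).support := fun hmem =>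
          absurd (hΦ t s hmem) (hmax t ht).not_gt
        rw [notMem_support_iff, coeff_sub, coeff_monomial, if_neg hts, sub_zero] at this
        rw [this, smul_zero]
    rw [h0, coeff_zero] at key
    exact (mem_support_iff.mp hs) key.symm
  · have hmon : ∀ (N : ℕ) (s : σ →₀ ℕ), Finsupp.weight w s = N →
        monomial s (1 : R) ∈ LinearMap.range Φ := by
      intro N
      induction N using Nat.strong_induction_on with
      | _ N ih =>
        intro s hs
        have h1 : Φ (monomial s 1) - monomial s 1 ∈ LinearMap.range Φ := by
          rw [hsum (Φ (monomial s 1) - monomial s 1)]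
          exact Submodule.sum_mem _ fun t ht => Submodule.smul_mem _ _
            (ih _ (hs ▸ hΦ s t ht) t rfl)
        have h2 := Submodule.sub_mem _ (LinearMap.mem_range_self Φ (monomial s 1)) h1
        rwa [sub_sub_cancel] at h2
    intro h
    rw [← LinearMap.mem_range, hsum h]
    exact Submodule.sum_mem _ fun s _ => Submodule.smul_mem _ _ (hmon _ s rfl)

theorem AddEquiv.map_mem_span_image {A : Type*} [CommRing A] {f m : κ → A} (Φ : A ≃+ A)
    (hΦ : ∀ c h, Φ (m c * h) = f c * Φ h) (D : Set κ) {h : A}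
    (hh : h ∈ Ideal.span (m '' D)) : Φ h ∈ Ideal.span (f '' D) := by
  induction hh using Submodule.span_induction with
  | mem x hx =>
    obtain ⟨c, hc, rfl⟩ := hx
    rw [← mul_one (m c), hΦ]
    exact Ideal.mul_mem_right _ _ (Ideal.subset_span ⟨c, hc, rfl⟩)
  | zero => simp
  | add x y _ _ hx hy => rw [map_add]; exact Ideal.add_mem _ hx hy
  | smul a x hx _ =>
    rw [smul_eq_mul]
    clear * - hx hΦ
    induction hx using Submodule.span_induction generalizing a with
    | mem x hx =>
      obtain ⟨c, hc, rfl⟩ := hx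
      rw [mul_comm, hΦ]
      exact Ideal.mul_mem_right _ _ (Ideal.subset_span ⟨c, hc, rfl⟩)
    | zero => simp
    | add x y _ _ hx hy => rw [mul_add, map_add]; exact Ideal.add_mem _ (hx a) (hy a)
    | smul b x _ hx => rw [smul_eq_mul, ← mul_assoc]; exact hx _

theorem mem_span_monomial_of_monomial_mul_mem {E : κ → σ →₀ ℕ}
    (hdisj : ∀ c d, c ≠ d → ∀ x, E c x = 0 ∨ E d x = 0) {D : Set κ} {c : κ} (hc : c ∉ D)
    {h : MvPolynomial σ R}
    (hh : monomial (E c) 1 * h ∈ Ideal.span ((fun d => monomial (E d) (1 : R)) '' D)) :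
    h ∈ Ideal.span ((fun d => monomial (E d) (1 : R)) '' D) := by
  have himg : (fun d => monomial (E d) (1 : R)) '' D =
      (fun s => monomial s (1 : R)) '' (E '' D) := by
    rw [Set.image_image]
  rw [himg, mem_ideal_span_monomial_image] at hh ⊢
  intro s hs
  obtain ⟨_, ⟨d, hd, rfl⟩, hle⟩ := hh (E c + s) (by
    rw [mem_support_iff] at hs ⊢
    rwa [coeff_monomial_mul, one_mul])
  refine ⟨E d, ⟨d, hd, rfl⟩, fun x => ?_⟩
  have := hle x
  rcases hdisj c d (fun h => hc (h ▸ hd)) x with h0 | h0 <;>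
    simp_all

/-- Polynomials with pairwise coprime leading monomials form a regular sequence, in any order. -/
theorem mem_span_of_mul_mem_of_coprime_leadingMonomial [Fintype κ] (w : σ → ℕ)
    {f : κ → MvPolynomial σ R} {E : κ → σ →₀ ℕ} (hE : ∀ c, E c ≠ 0)
    (hdisj : ∀ c d, c ≠ d → ∀ x, E c x = 0 ∨ E d x = 0)
    (hf : ∀ c, HasLeadingMonomial w (f c) (E c)) {D : Set κ} {c : κ} (hc : c ∉ D)
    {g : MvPolynomial σ R} (hg : f c * g ∈ Ideal.span (f '' D)) : g ∈ Ideal.span (f '' D) := by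
  classical
  choose e he using fun c s => exists_forall_nsmul_le_iff (hE c) s
  have he_self : ∀ c s, e c (s + E c) = e c s + 1 := fun c s => by
    refine eq_of_forall_le_iff fun k => ?_
    rw [← he]
    cases k with
    | zero => simp
    | succ k => rw [succ_nsmul, add_le_add_iff_right, he, Nat.succ_le_succ_iff]
  have he_ne : ∀ c d s, c ≠ d → e d (s + E c) = e d s := fun c d s hcd => by
    refine eq_of_forall_le_iff fun k => ?_
    rw [← he, ← he, Finsupp.le_def, Finsupp.le_def]
    refine forall_congr' fun x => ?_
    rcases hdisj c d hcd x with h0 | h0 <;> simp [h0]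
  have hle : ∀ s, ∑ c, e c s • E c ≤ s := fun s x => by
    rw [Finsupp.finsetSum_apply]
    by_cases hx : ∃ c, E c x ≠ 0
    · obtain ⟨c, hc⟩ := hx
      rw [Finset.sum_eq_single c]
      · exact (he c s _).mpr le_rfl x
      · intro d _ hd
        rw [Finsupp.smul_apply, (hdisj d c hd x).resolve_right hc, smul_zero]
      · simp
    · push Not at hx
      simp [hx]
  let G : (σ →₀ ℕ) → MvPolynomial σ R := fun s =>
    monomial (s - ∑ c, e c s • E c) 1 * ∏ c, f c ^ e c s
  have hG : ∀ s, HasLeadingMonomial w (G s) s := fun s => by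
    have := (hasLeadingMonomial_monomial (R := R) w (s - ∑ c, e c s • E c)).mul
      (HasLeadingMonomial.prod (fun c => (hf c).pow (e c s)) Finset.univ)
    rwa [tsub_add_cancel_of_le (hle s)] at this
  have hGmul : ∀ c s, G (s + E c) = f c * G s := fun c s => by
    have h1 : ∑ d, e d (s + E c) • E d = ∑ d, e d s • E d + E c := by
      rw [← Finset.add_sum_erase _ _ (Finset.mem_univ c),
        ← Finset.add_sum_erase (a := c) _ (fun d => e d s • E d) (Finset.mem_univ c), he_self,
        Finset.sum_congr rfl fun d hd => by rw [he_ne c d s (Finset.ne_of_mem_erase hd).symm],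
        succ_nsmul]
      abel
    have h2 : ∏ d, f d ^ e d (s + E c) = f c * ∏ d, f d ^ e d s := by
      rw [← Finset.mul_prod_erase _ _ (Finset.mem_univ c),
        ← Finset.mul_prod_erase (a := c) _ (fun d => f d ^ e d s) (Finset.mem_univ c), he_self,
        Finset.prod_congr rfl fun d hd => by rw [he_ne c d s (Finset.ne_of_mem_erase hd).symm],
        pow_succ]
      ring
    simp only [G, h1, h2, add_tsub_add_eq_tsub_right]
    ring
  let Φ := (basisMonomials σ R).constr R G
  have hΦ : ∀ s, Φ (monomial s 1) = G s := fun s => by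
    have := (basisMonomials σ R).constr_basis R G s
    rwa [coe_basisMonomials] at this
  have hbij : Function.Bijective Φ := bijective_of_hasLeadingMonomial w Φ fun s => by
    rw [hΦ]; exact hG s
  have hmul : ∀ c h, Φ (monomial (E c) 1 * h) = f c * Φ h := fun c h => by
    suffices Φ ∘ₗ LinearMap.mulLeft R (monomial (E c) 1) = LinearMap.mulLeft R (f c) ∘ₗ Φ from
      LinearMap.congr_fun this h
    refine (basisMonomials σ R).ext fun s => ?_
    simp only [coe_basisMonomials, LinearMap.comp_apply, LinearMap.mulLeft_apply, monomial_mul,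
      one_mul, hΦ, ← hGmul, add_comm s]
  let Ψ : MvPolynomial σ R ≃+ MvPolynomial σ R := AddEquiv.ofBijective Φ.toAddMonoidHom hbij
  have hΨ : ∀ c h, Ψ (monomial (E c) 1 * h) = f c * Ψ h := hmul
  obtain ⟨h, rfl⟩ := Ψ.surjective g
  rw [← hΨ] at hg
  refine Ψ.map_mem_span_image hΨ D (mem_span_monomial_of_monomial_mul_mem hdisj hc ?_)
  have hsymm : ∀ c h, Ψ.symm (f c * h) = monomial (E c) 1 * Ψ.symm h := fun c h => by
    rw [AddEquiv.symm_apply_eq, hΨ, AddEquiv.apply_symm_apply]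
  simpa using Ψ.symm.map_mem_span_image hsymm D hg

end CoprimeLeadingTerms

section Dimension

/-- Killing the elements of a regular sequence lowers the Krull dimension by at least its length. -/
theorem ringKrullDim_quotient_span_image_add_card_le {κ A : Type*} [CommRing A] {f : κ → A}
    (hf : ∀ (D : Set κ) (c : κ), c ∉ D → ∀ g, f c * g ∈ Ideal.span (f '' D) →
      g ∈ Ideal.span (f '' D)) (D : Finset κ) :
    ringKrullDim (A ⧸ Ideal.span (f '' (D : Set κ))) + (D.card : ℕ) ≤ ringKrullDim A := by
  classical
  induction D using Finset.induction_on with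
  | empty => simpa using ringKrullDim_quotient_le (Ideal.span (f '' ((∅ : Finset κ) : Set κ)))
  | insert c D hc ih =>
    refine le_trans ?_ ih
    rw [Finset.card_insert_of_notMem hc, Nat.cast_add, Nat.cast_one, add_comm (D.card : WithBot ℕ∞),
      ← add_assoc]
    gcongr
    have hle : Ideal.span (f '' (D : Set κ)) ≤ Ideal.span (f '' (insert c D : Finset κ)) :=
      Ideal.span_mono (Set.image_mono (by simp))
    refine ringKrullDim_succ_le_of_surjective (Ideal.Quotient.factor hle)
      (Ideal.Quotient.factor_surjective hle) (r := Ideal.Quotient.mk _ (f c)) ?_ ?_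
    · rw [mem_nonZeroDivisors_iff_left]
      intro x hx
      obtain ⟨g, rfl⟩ := Ideal.Quotient.mk_surjective x
      rw [← map_mul, Ideal.Quotient.eq_zero_iff_mem] at hx
      exact Ideal.Quotient.eq_zero_iff_mem.mpr (hf D c (by simpa using hc) g hx)
    · rw [Ideal.Quotient.factor_mk, Ideal.Quotient.eq_zero_iff_mem]
      exact Ideal.subset_span ⟨c, by simp, rfl⟩

/-- The ideal of the origin in affine space over a field has full height. -/
theorem card_le_height_ker_constantCoeff (σ K : Type*) [Fintype σ] [Field K] :
    (Fintype.card σ : ℕ∞) ≤ (RingHom.ker (constantCoeff : MvPolynomial σ K →+* K)).height := by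
  classical
  let z : Finset σ → MvPolynomial σ K →ₐ[K] MvPolynomial σ K := fun D =>
    aeval fun i => if i ∈ D then 0 else X i
  have hprime : ∀ D, (RingHom.ker (z D)).IsPrime := fun D => RingHom.ker_isPrime _
  have key : ∀ D : Finset σ, (D.card : ℕ∞) ≤ (RingHom.ker (z D)).height := by
    intro D
    induction D using Finset.induction_on with
    | empty => simp
    | insert c D hc ih =>
      rw [Finset.card_insert_of_notMem hc, Nat.cast_add, Nat.cast_one]
      have hcomp : (z (insert c D)).comp (z D) = z (insert c D) := by
        refine algHom_ext fun i => ?_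
        simp only [z, AlgHom.comp_apply, aeval_X]
        by_cases hi : i ∈ D <;> simp [hi]
      have hlt : RingHom.ker (z D) < RingHom.ker (z (insert c D)) := by
        refine lt_of_le_of_ne (fun g hg => ?_) fun heq => ?_
        · rw [RingHom.mem_ker] at hg ⊢
          rw [← hcomp, AlgHom.comp_apply, hg, map_zero]
        · have h1 : (X c : MvPolynomial σ K) ∈ RingHom.ker (z (insert c D)) := by
            simp [RingHom.mem_ker, z]
          rw [← heq, RingHom.mem_ker] at h1
          simp [z, hc] at h1
      exact (add_le_add_left ih 1).trans (Ideal.height_add_one_le_of_lt_of_isPrime hlt)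
  refine (key Finset.univ).trans (Ideal.height_mono fun g hg => ?_)
  rw [RingHom.mem_ker] at hg ⊢
  have h0 : z Finset.univ g = C (constantCoeff g) := by
    refine RingHom.congr_fun (f := (z Finset.univ : MvPolynomial σ K →+* MvPolynomial σ K))
      (g := C.comp constantCoeff) (ringHom_ext (fun r => ?_) fun i => ?_) g <;> simp [z]
  exact (C_injective σ K) (by rw [← h0, hg, map_zero])

end Dimension

section Gluing

theorem dvd_of_pow_dvd_mul_pow {A : Type*} [CommRing A] {x y : A} (hx : x ∈ nonZeroDivisors A)
    (hxy : ∀ a, x ∣ y * a → x ∣ a) (k l : ℕ) : ∀ a, x ^ k ∣ y ^ l * a → x ^ k ∣ a := by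
  have h1 : ∀ (l : ℕ) (a : A), x ∣ y ^ l * a → x ∣ a := by
    intro l
    induction l with
    | zero => simp
    | succ l ih => exact fun a h => ih a (hxy _ (by rwa [← mul_assoc, ← pow_succ']))
  induction k with
  | zero => simp
  | succ k ih =>
    intro a h
    obtain ⟨b, rfl⟩ := h1 l a ((dvd_pow_self x k.succ_ne_zero).trans h)
    rw [pow_succ', mul_left_comm] at h
    rw [pow_succ']
    refine mul_dvd_mul_left x (ih b ?_)
    obtain ⟨c, hc⟩ := h
    exact ⟨c, mul_cancel_left_mem_nonZeroDivisors hx |>.mp (by rw [hc]; ring)⟩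

/-- If the localization at `z` is integrally closed, integral fractions have a power of `z` as a
denominator. -/
theorem exists_pow_mul_eq_of_isIntegral_of_away {A K : Type*} (L : Type*) [CommRing A] [IsDomain A]
    [Field K] [Algebra A K] [IsFractionRing A K] [CommRing L] [Algebra A L] {z : A}
    [IsLocalization.Away z L] [IsIntegrallyClosed L] (hz : z ∈ nonZeroDivisors A) (f : K)
    (hf : IsIntegral A f) :
    ∃ (k : ℕ) (u : A), algebraMap A K (z ^ k) * f = algebraMap A K u := by
  have hunit : IsUnit (algebraMap A K z) :=
    IsLocalization.map_units K (⟨z, hz⟩ : nonZeroDivisors A)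
  let : Algebra L K := (IsLocalization.Away.lift z hunit).toAlgebra
  have : IsScalarTower A L K := IsScalarTower.of_algebraMap_eq fun a =>
    (IsLocalization.Away.lift_eq z hunit a).symm
  have : IsFractionRing L K :=
    IsFractionRing.isFractionRing_of_isDomain_of_isLocalization (Submonoid.powers z) L K
  obtain ⟨g, rfl⟩ := (isIntegrallyClosed_iff K).mp ‹IsIntegrallyClosed L› (hf.tower_top (A := L))
  obtain ⟨⟨u, ⟨_, k, rfl⟩⟩, hu⟩ := IsLocalization.surj (Submonoid.powers z) g
  refine ⟨k, u, ?_⟩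
  rw [IsScalarTower.algebraMap_apply A L K, IsScalarTower.algebraMap_apply A L K u, ← hu, map_mul,
    mul_comm]

/-- If `x, y` is a regular sequence and the localizations at `x` and at `y` are integrally closed
domains, then so is the ring. -/
theorem isDomain_and_isIntegrallyClosed_of_away {A B C : Type*} [CommRing A] [CommRing B]
    [CommRing C] [Algebra A B] [Algebra A C] {x y : A} [IsLocalization.Away x B]
    [IsLocalization.Away y C] [IsDomain B] [IsIntegrallyClosed B]
    [IsIntegrallyClosed C] (hx : x ∈ nonZeroDivisors A) (hy : y ∈ nonZeroDivisors A)
    (hxy : ∀ a, x ∣ y * a → x ∣ a) : IsDomain A ∧ IsIntegrallyClosed A := by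
  have hinj : Function.Injective (algebraMap A B) :=
    IsLocalization.injective B (Submonoid.powers_le.mpr hx)
  have hA : IsDomain A := hinj.isDomain
  refine ⟨hA, ?_⟩
  let K := FractionRing A
  rw [isIntegrallyClosed_iff K]
  intro f hf
  obtain ⟨k, u, hu⟩ := exists_pow_mul_eq_of_isIntegral_of_away B hx f hf
  obtain ⟨l, v, hv⟩ := exists_pow_mul_eq_of_isIntegral_of_away C hy f hf
  have hKinj : Function.Injective (algebraMap A K) := IsFractionRing.injective A K
  have huv : y ^ l * u = x ^ k * v := hKinj (by
    rw [map_mul, map_mul, ← hu, ← hv]; ring)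
  obtain ⟨a, rfl⟩ := dvd_of_pow_dvd_mul_pow hx hxy k l u ⟨v, huv⟩
  refine ⟨a, ?_⟩
  have hne : algebraMap A K (x ^ k) ≠ 0 := by
    rw [map_ne_zero_iff _ hKinj]
    exact pow_ne_zero _ (nonZeroDivisors.ne_zero hx)
  rw [map_mul] at hu
  exact (mul_left_cancel₀ hne hu).symm

theorem MvPolynomial.isIntegrallyClosed (σ A : Type*) [Finite σ] [CommRing A] [IsDomain A]
    [IsIntegrallyClosed A] : IsIntegrallyClosed (MvPolynomial σ A) := by
  induction σ using Finite.induction_empty_option with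
  | of_equiv e ih => exact .of_equiv (renameEquiv A e).toRingEquiv
  | h_empty => exact .of_equiv (isEmptyRingEquiv A PEmpty).symm
  | h_option ih => exact .of_equiv (optionEquivLeft A _).symm.toRingEquiv

end Gluing

/-- The coordinate ring of the null cone. -/
abbrev NullConeRing (p m n : ℕ) : Type :=
  MvPolynomial ((Fin p × Fin m) ⊕ (Fin p × Fin n)) ℂ ⧸ nullConeIdealU p m n

namespace NullConeRing

variable {p m n : ℕ}

/-- The coordinate function `a_{k,i}`. -/
noncomputable def a (k : Fin p) (i : Fin m) : NullConeRing p m n :=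
  Ideal.Quotient.mk _ (X (Sum.inl (k, i)))

/-- The coordinate function `b_{k,j}`. -/
noncomputable def b (k : Fin p) (j : Fin n) : NullConeRing p m n :=
  Ideal.Quotient.mk _ (X (Sum.inr (k, j)))

theorem sum_a_mul_b (i : Fin m) (j : Fin n) :
    ∑ k, (a k i * b k j : NullConeRing p m n) = 0 := by
  simp only [a, b, ← map_mul, ← map_sum]
  exact Ideal.Quotient.eq_zero_iff_mem.mpr (Ideal.subset_span ⟨i, j, rfl⟩)

theorem sum_b_mul_a (j : Fin n) (i : Fin m) :
    ∑ k, (b k j * a k i : NullConeRing p m n) = 0 := by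
  simpa only [mul_comm] using sum_a_mul_b i j

section Lift

variable {A : Type*} [CommRing A] [Algebra ℂ A]

/-- The universal property of the null cone: an algebra map is a pair of matrices `a`, `b` with
`aᵀ b = 0`. -/
noncomputable def lift (x : Fin p → Fin m → A) (y : Fin p → Fin n → A)
    (h : ∀ i j, ∑ k, x k i * y k j = 0) : NullConeRing p m n →ₐ[ℂ] A :=
  Ideal.Quotient.liftₐ _ (aeval (Sum.elim (fun s => x s.1 s.2) fun s => y s.1 s.2)) <| by
    intro g hg
    suffices nullConeIdealU p m n ≤ RingHom.ker
      (aeval (R := ℂ) (Sum.elim (fun s : Fin p × Fin m => x s.1 s.2)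
        fun s : Fin p × Fin n => y s.1 s.2)) from this hg
    refine Ideal.span_le.mpr ?_
    rintro _ ⟨i, j, rfl⟩
    simpa using h i j

@[simp]
theorem lift_a (x : Fin p → Fin m → A) (y : Fin p → Fin n → A)
    (h : ∀ i j, ∑ k, x k i * y k j = 0) (k : Fin p) (i : Fin m) : lift x y h (a k i) = x k i := by
  change aeval (R := ℂ) _ (X _) = _
  simp

@[simp]
theorem lift_b (x : Fin p → Fin m → A) (y : Fin p → Fin n → A)
    (h : ∀ i j, ∑ k, x k i * y k j = 0) (k : Fin p) (j : Fin n) : lift x y h (b k j) = y k j := by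
  change aeval (R := ℂ) _ (X _) = _
  simp

theorem algHom_ext {f g : NullConeRing p m n →ₐ[ℂ] A} (ha : ∀ k i, f (a k i) = g (a k i))
    (hb : ∀ k j, f (b k j) = g (b k j)) : f = g := by
  refine Ideal.Quotient.algHom_ext _ (MvPolynomial.algHom_ext ?_)
  rintro (⟨k, i⟩ | ⟨k, j⟩)
  · exact ha k i
  · exact hb k j

end Lift

/-- Transposing the defining equations exchanges the two matrices. -/
noncomputable def swap (p m n : ℕ) : NullConeRing p m n ≃ₐ[ℂ] NullConeRing p n m :=
  AlgEquiv.ofAlgHom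
    (lift b a sum_b_mul_a)
    (lift b a sum_b_mul_a)
    (algHom_ext (by simp) (by simp)) (algHom_ext (by simp) (by simp))

theorem swap_b (k : Fin p) (j : Fin n) : swap p m n (b k j) = a k j :=
  lift_b b a sum_b_mul_a k j

section Pivot

variable (p m n)

/-- Eliminating the pivot row from a pair of orthogonality relations. -/
theorem sum_sub_mul_eq_zero {A κ : Type*} [CommRing A] [Fintype κ] {c d y : κ → A} {x z l u : A}
    (hu : x * u = 1) (hc : ∑ k, c k * y k + x * l = 0) (hd : ∑ k, d k * y k + z * l = 0) :
    ∑ k, (d k - c k * z * u) * y k = 0 := by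
  have h : ∑ k, (d k - c k * z * u) * y k = ∑ k, d k * y k - z * u * ∑ k, c k * y k := by
    rw [Finset.mul_sum, ← Finset.sum_sub_distrib]
    exact Finset.sum_congr rfl fun k _ => by ring
  rw [h]
  linear_combination hd - z * u * hc + z * l * hu

/-- The ring obtained from a smaller null cone by adjoining the entries of the pivot row and
column. -/
abbrev PivotPoly : Type := MvPolynomial (Option (Fin p ⊕ Fin m)) (NullConeRing p m n)

/-- The localization of `PivotPoly` at the pivot. -/
abbrev PivotRing : Type := Localization.Away (X none : PivotPoly p m n)

/-- The localization of the null cone at the pivot `a_{last,0}`. -/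
abbrev Away : Type :=
  Localization.Away (a (Fin.last p) 0 : NullConeRing (p + 1) (m + 1) n)

/-- Row reduction with respect to the pivot, on coordinates. -/
noncomputable def toPivotRingAux : NullConeRing (p + 1) (m + 1) n →ₐ[ℂ] PivotRing p m n :=
  lift
    (fun k i => Fin.lastCases (motive := fun _ => PivotRing p m n)
      (Fin.cases (motive := fun _ => PivotRing p m n) (algebraMap (PivotPoly p m n) _ (X none))
        (fun i => algebraMap (PivotPoly p m n) _ (X (some (Sum.inr i)))) i)
      (fun k => Fin.cases (motive := fun _ => PivotRing p m n)
        (algebraMap (PivotPoly p m n) _ (X (some (Sum.inl k))))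
        (fun i => algebraMap (PivotPoly p m n) _ (C (a k i)) +
          algebraMap (PivotPoly p m n) _ (X (some (Sum.inl k))) *
            algebraMap (PivotPoly p m n) _ (X (some (Sum.inr i))) *
            IsLocalization.Away.invSelf (X none : PivotPoly p m n)) i) k)
    (fun k j => Fin.lastCases (motive := fun _ => PivotRing p m n)
      (-(IsLocalization.Away.invSelf (X none : PivotPoly p m n) *
        ∑ k : Fin p, algebraMap (PivotPoly p m n) _ (X (some (Sum.inl k))) *
          algebraMap (PivotPoly p m n) _ (C (b k j))))
      (fun k => algebraMap (PivotPoly p m n) _ (C (b k j))) k) <| by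
    intro i j
    have hinv := IsLocalization.Away.mul_invSelf (S := PivotRing p m n)
      (X none : PivotPoly p m n)
    refine Fin.cases ?_ (fun i => ?_) i
    · simp only [Fin.sum_univ_castSucc, Fin.lastCases_castSucc, Fin.lastCases_last, Fin.cases_zero]
      linear_combination (-∑ k : Fin p, algebraMap (PivotPoly p m n) (PivotRing p m n)
        (X (some (Sum.inl k))) * algebraMap (PivotPoly p m n) (PivotRing p m n) (C (b k j))) * hinv
    · simp only [Fin.sum_univ_castSucc, Fin.lastCases_castSucc, Fin.lastCases_last, Fin.cases_succ]
      have h0 : ∑ k : Fin p, algebraMap (PivotPoly p m n) (PivotRing p m n) (C (a k i)) *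
          algebraMap (PivotPoly p m n) (PivotRing p m n) (C (b k j)) = 0 := by
        simp only [← map_mul, ← map_sum, sum_a_mul_b, map_zero]
      simp only [add_mul, Finset.sum_add_distrib, h0, mul_neg, Finset.mul_sum, zero_add,
        ← sub_eq_add_neg, ← Finset.sum_sub_distrib]
      exact Finset.sum_eq_zero fun k _ => by ring

theorem toPivotRingAux_pivot :
    toPivotRingAux p m n (a (Fin.last p) 0) = algebraMap (PivotPoly p m n) _ (X none) := by
  simp [toPivotRingAux]

theorem isUnit_toPivotRingAux_pivot : IsUnit (toPivotRingAux p m n (a (Fin.last p) 0)) := by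
  rw [toPivotRingAux_pivot]
  exact IsLocalization.Away.algebraMap_isUnit _

/-- Row reduction with respect to the pivot. -/
noncomputable def toPivotRing : Away p m n →ₐ[ℂ] PivotRing p m n :=
  IsLocalization.Away.liftAlgHom (a (Fin.last p) 0 : NullConeRing (p + 1) (m + 1) n)
    (f := toPivotRingAux p m n) (isUnit_toPivotRingAux_pivot p m n)

/-- The inverse of row reduction, before localizing. -/
noncomputable def ofPivotRingAux : PivotPoly p m n →ₐ[ℂ] Away p m n :=
  aevalTower
    (lift
      (fun k i => algebraMap (NullConeRing (p + 1) (m + 1) n) _ (a k.castSucc i.succ) -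
        algebraMap (NullConeRing (p + 1) (m + 1) n) _ (a k.castSucc 0) *
          algebraMap (NullConeRing (p + 1) (m + 1) n) _ (a (Fin.last p) i.succ) *
          IsLocalization.Away.invSelf (a (Fin.last p) 0 : NullConeRing (p + 1) (m + 1) n))
      (fun k j => algebraMap (NullConeRing (p + 1) (m + 1) n) _ (b k.castSucc j)) <| by
        intro i j
        have hinv := IsLocalization.Away.mul_invSelf (S := Away p m n)
          (a (Fin.last p) 0 : NullConeRing (p + 1) (m + 1) n)
        have h0 := congrArg (algebraMap (NullConeRing (p + 1) (m + 1) n) (Away p m n))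
          (sum_a_mul_b (0 : Fin (m + 1)) j)
        have h1 := congrArg (algebraMap (NullConeRing (p + 1) (m + 1) n) (Away p m n))
          (sum_a_mul_b i.succ j)
        simp only [Fin.sum_univ_castSucc, map_add, map_sum, map_mul, map_zero] at h0 h1
        exact sum_sub_mul_eq_zero hinv h0 h1)
    (fun o => algebraMap (NullConeRing (p + 1) (m + 1) n) _ <|
      Option.elim o (a (Fin.last p) 0)
        (Sum.elim (fun k => a k.castSucc 0) fun i => a (Fin.last p) i.succ))

theorem isUnit_ofPivotRingAux_pivot : IsUnit (ofPivotRingAux p m n (X none)) := by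
  rw [ofPivotRingAux, aevalTower_X]
  exact IsLocalization.Away.algebraMap_isUnit
    (a (Fin.last p) 0 : NullConeRing (p + 1) (m + 1) n)

/-- The inverse of row reduction. -/
noncomputable def ofPivotRing : PivotRing p m n →ₐ[ℂ] Away p m n :=
  IsLocalization.Away.liftAlgHom (X none : PivotPoly p m n) (f := ofPivotRingAux p m n)
    (isUnit_ofPivotRingAux_pivot p m n)

variable {p m n}

@[simp]
theorem toPivotRing_algebraMap (r : NullConeRing (p + 1) (m + 1) n) :
    toPivotRing p m n (algebraMap _ _ r) = toPivotRingAux p m n r :=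
  IsLocalization.Away.lift_eq _ (isUnit_toPivotRingAux_pivot p m n) _

@[simp]
theorem ofPivotRing_algebraMap (r : PivotPoly p m n) :
    ofPivotRing p m n (algebraMap _ _ r) = ofPivotRingAux p m n r :=
  IsLocalization.Away.lift_eq _ (isUnit_ofPivotRingAux_pivot p m n) _

@[simp]
theorem ofPivotRingAux_X (o : Option (Fin p ⊕ Fin m)) : ofPivotRingAux p m n (X o) =
    algebraMap (NullConeRing (p + 1) (m + 1) n) _ (Option.elim o (a (Fin.last p) 0)
      (Sum.elim (fun k => a k.castSucc 0) fun i => a (Fin.last p) i.succ)) :=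
  aevalTower_X _ _ _

@[simp]
theorem ofPivotRingAux_C_a (k : Fin p) (i : Fin m) : ofPivotRingAux p m n (C (a k i)) =
    algebraMap (NullConeRing (p + 1) (m + 1) n) _ (a k.castSucc i.succ) -
      algebraMap (NullConeRing (p + 1) (m + 1) n) _ (a k.castSucc 0) *
        algebraMap (NullConeRing (p + 1) (m + 1) n) _ (a (Fin.last p) i.succ) *
        IsLocalization.Away.invSelf (a (Fin.last p) 0 : NullConeRing (p + 1) (m + 1) n) :=
  (aevalTower_C _ _ _).trans (lift_a _ _ _ _ _)

@[simp]
theorem ofPivotRingAux_C_b (k : Fin p) (j : Fin n) : ofPivotRingAux p m n (C (b k j)) =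
    algebraMap (NullConeRing (p + 1) (m + 1) n) _ (b k.castSucc j) :=
  (aevalTower_C _ _ _).trans (lift_b _ _ _ _ _)

@[simp]
theorem toPivotRing_invSelf : toPivotRing p m n
    (IsLocalization.Away.invSelf (a (Fin.last p) 0 : NullConeRing (p + 1) (m + 1) n)) =
      IsLocalization.Away.invSelf (X none : PivotPoly p m n) := by
  have h := congrArg (toPivotRing p m n) (IsLocalization.Away.mul_invSelf (S := Away p m n)
    (a (Fin.last p) 0 : NullConeRing (p + 1) (m + 1) n))
  rw [map_mul, map_one, toPivotRing_algebraMap, toPivotRingAux_pivot, mul_comm] at h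
  exact left_inv_eq_right_inv h (IsLocalization.Away.mul_invSelf _)

@[simp]
theorem ofPivotRing_invSelf : ofPivotRing p m n
    (IsLocalization.Away.invSelf (X none : PivotPoly p m n)) =
      IsLocalization.Away.invSelf (a (Fin.last p) 0 : NullConeRing (p + 1) (m + 1) n) := by
  have h := congrArg (ofPivotRing p m n) (IsLocalization.Away.mul_invSelf (S := PivotRing p m n)
    (X none : PivotPoly p m n))
  rw [map_mul, map_one, ofPivotRing_algebraMap, ofPivotRingAux_X, mul_comm] at h
  exact left_inv_eq_right_inv h (IsLocalization.Away.mul_invSelf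
    (a (Fin.last p) 0 : NullConeRing (p + 1) (m + 1) n))

theorem toPivotRing_comp_ofPivotRing :
    (toPivotRing p m n).comp (ofPivotRing p m n) = AlgHom.id ℂ _ := by
  refine IsLocalization.algHom_ext (Submonoid.powers (X none : PivotPoly p m n))
    (algHom_ext' (algHom_ext (fun k i => ?_) fun k j => ?_) ?_)
  · change toPivotRing p m n (ofPivotRing p m n (algebraMap (PivotPoly p m n) _ (C (a k i)))) =
      algebraMap (PivotPoly p m n) _ (C (a k i))
    simp only [ofPivotRing_algebraMap, ofPivotRingAux_C_a, map_sub, map_mul,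
      toPivotRing_algebraMap, toPivotRing_invSelf]
    simp [toPivotRingAux]
  · change toPivotRing p m n (ofPivotRing p m n (algebraMap (PivotPoly p m n) _ (C (b k j)))) =
      algebraMap (PivotPoly p m n) _ (C (b k j))
    simp [toPivotRingAux]
  · intro o
    change toPivotRing p m n (ofPivotRing p m n (algebraMap _ _ (X o))) = algebraMap _ _ (X o)
    rw [ofPivotRing_algebraMap, ofPivotRingAux_X, toPivotRing_algebraMap]
    obtain _ | k | i := o <;> simp [toPivotRingAux]

theorem ofPivotRing_comp_toPivotRing :
    (ofPivotRing p m n).comp (toPivotRing p m n) = AlgHom.id ℂ _ := by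
  have hinv := IsLocalization.Away.mul_invSelf (S := Away p m n)
    (a (Fin.last p) 0 : NullConeRing (p + 1) (m + 1) n)
  refine IsLocalization.algHom_ext
    (Submonoid.powers (a (Fin.last p) 0 : NullConeRing (p + 1) (m + 1) n))
    (algHom_ext (fun k i => ?_) fun k j => ?_)
  · change ofPivotRing p m n (toPivotRing p m n (algebraMap _ _ (a k i))) = algebraMap _ _ (a k i)
    rw [toPivotRing_algebraMap]
    refine Fin.lastCases ?_ (fun k => ?_) k <;> refine Fin.cases ?_ (fun i => ?_) i <;>
      simp [toPivotRingAux]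
  · change ofPivotRing p m n (toPivotRing p m n (algebraMap _ _ (b k j))) = algebraMap _ _ (b k j)
    rw [toPivotRing_algebraMap]
    refine Fin.lastCases ?_ (fun k => ?_) k
    · have h0 := congrArg (algebraMap (NullConeRing (p + 1) (m + 1) n) (Away p m n))
        (sum_a_mul_b (0 : Fin (m + 1)) j)
      simp only [Fin.sum_univ_castSucc, map_add, map_sum, map_mul, map_zero] at h0
      simp only [toPivotRingAux, lift_b, Fin.lastCases_last, map_neg, map_mul, map_sum,
        ofPivotRing_algebraMap, ofPivotRing_invSelf, ofPivotRingAux_X, ofPivotRingAux_C_b,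
        Option.elim_some, Sum.elim_inl]
      linear_combination (-IsLocalization.Away.invSelf
        (a (Fin.last p) 0 : NullConeRing (p + 1) (m + 1) n)) * h0 +
        algebraMap (NullConeRing (p + 1) (m + 1) n) (Away p m n) (b (Fin.last p) j) * hinv
    · simp [toPivotRingAux]

variable (p m n)

/-- Away from the pivot, the null cone is an open subset of an affine space over a smaller null
cone. -/
noncomputable def awayEquiv : Away p m n ≃ₐ[ℂ] PivotRing p m n :=
  AlgEquiv.ofAlgHom (toPivotRing p m n) (ofPivotRing p m n) toPivotRing_comp_ofPivotRing
    ofPivotRing_comp_toPivotRing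

end Pivot
end NullConeRing

section Degeneration

variable {p m n : ℕ}

/-- The equations of the null cone, followed by the variables in the last row. -/
noncomputable def nullConeSequence (p m n : ℕ) : (Fin m × Fin n) ⊕ (Fin m ⊕ Fin n) →
    MvPolynomial ((Fin (p + 1) × Fin m) ⊕ (Fin (p + 1) × Fin n)) ℂ :=
  Sum.elim (fun c => ∑ k, X (Sum.inl (k, c.1)) * X (Sum.inr (k, c.2)))
    (Sum.elim (fun i => X (Sum.inl (Fin.last p, i))) fun j => X (Sum.inr (Fin.last p, j)))

/-- The row in which the `(i, j)` equation has its leading term. -/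
def leadingRow (h : m + n ≤ p + 1) (c : Fin m × Fin n) : Fin p :=
  ⟨c.1 + c.2, by omega⟩

/-- The leading exponents of `nullConeSequence`. -/
noncomputable def leadingExponent (h : m + n ≤ p + 1) : (Fin m × Fin n) ⊕ (Fin m ⊕ Fin n) →
    (Fin (p + 1) × Fin m) ⊕ (Fin (p + 1) × Fin n) →₀ ℕ :=
  Sum.elim
    (fun c => Finsupp.single (Sum.inl ((leadingRow h c).castSucc, c.1)) 1 +
      Finsupp.single (Sum.inr ((leadingRow h c).castSucc, c.2)) 1)
    (Sum.elim (fun i => Finsupp.single (Sum.inl (Fin.last p, i)) 1)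
      fun j => Finsupp.single (Sum.inr (Fin.last p, j)) 1)

/-- A weight for which `a_{i+j,i} b_{i+j,j}` is the leading term of the `(i, j)` equation. -/
def antidiagonalWeight (p m n : ℕ) : (Fin (p + 1) × Fin m) ⊕ (Fin (p + 1) × Fin n) → ℕ :=
  Sum.elim (fun s => (p * p - s.1 * s.1) + 4 * s.1 * s.2)
    fun s => (p * p - s.1 * s.1) + 4 * s.1 * s.2

theorem leadingExponent_ne_zero (h : m + n ≤ p + 1) (c : (Fin m × Fin n) ⊕ (Fin m ⊕ Fin n)) :
    leadingExponent h c ≠ 0 := by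
  rcases c with c | i | j <;> simp [leadingExponent]

theorem leadingExponent_disjoint (h : m + n ≤ p + 1) (c d : (Fin m × Fin n) ⊕ (Fin m ⊕ Fin n))
    (hcd : c ≠ d) (x : (Fin (p + 1) × Fin m) ⊕ (Fin (p + 1) × Fin n)) :
    leadingExponent h c x = 0 ∨ leadingExponent h d x = 0 := by
  by_contra! hx
  apply hcd
  rcases c with ⟨i, j⟩ | i | j <;> rcases d with ⟨i', j'⟩ | i' | j' <;>
    rcases x with ⟨k, l⟩ | ⟨k, l⟩ <;>
    simp [leadingExponent, leadingRow, Finsupp.single_apply, Fin.ext_iff] at hx ⊢ <;> omega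

theorem weight_leadingExponent_lt {k c i j : ℕ} (hk : k ≤ p) (hc : c ≤ p) (hij : c = i + j)
    (hkc : k ≠ c) :
    ((p * p - k * k) + 4 * k * i) + ((p * p - k * k) + 4 * k * j) <
      ((p * p - c * c) + 4 * c * i) + ((p * p - c * c) + 4 * c * j) := by
  have h1 : k * k ≤ p * p := Nat.mul_self_le_mul_self hk
  have h2 : c * c ≤ p * p := Nat.mul_self_le_mul_self hc
  subst hij
  zify [h1, h2]
  have h3 : 0 < ((k : ℤ) - (i + j)) ^ 2 := by
    have : (k : ℤ) - (i + j) ≠ 0 := by omega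
    positivity
  nlinarith

theorem hasLeadingMonomial_nullConeSequence (h : m + n ≤ p + 1)
    (c : (Fin m × Fin n) ⊕ (Fin m ⊕ Fin n)) :
    HasLeadingMonomial (antidiagonalWeight p m n) (nullConeSequence p m n c)
      (leadingExponent h c) := by
  classical
  rcases c with c | i | j
  · intro t ht
    have hX : ∀ k : Fin (p + 1), (X (Sum.inl (k, c.1)) * X (Sum.inr (k, c.2)) :
        MvPolynomial ((Fin (p + 1) × Fin m) ⊕ (Fin (p + 1) × Fin n)) ℂ) =
        monomial (Finsupp.single (Sum.inl (k, c.1)) 1 + Finsupp.single (Sum.inr (k, c.2)) 1) 1 :=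
      fun k => by simp [X, monomial_mul]
    simp only [nullConeSequence, leadingExponent, Sum.elim_inl, hX] at ht ⊢
    rw [← Finset.add_sum_erase _ _ (Finset.mem_univ (leadingRow h c).castSucc),
      add_sub_cancel_left] at ht
    obtain ⟨k, hk, ht⟩ := Finset.mem_biUnion.mp (support_sum ht)
    obtain rfl := Finset.mem_singleton.mp (support_monomial_subset ht)
    have hne : (k : ℕ) ≠ leadingRow h c := fun heq =>
      Finset.ne_of_mem_erase hk (Fin.ext heq)
    simpa [antidiagonalWeight, Finsupp.weight_single] using
      weight_leadingExponent_lt (p := p) (i := c.1) (j := c.2) (by omega)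
        (leadingRow h c).isLt.le rfl hne
  · exact hasLeadingMonomial_monomial _ _
  · exact hasLeadingMonomial_monomial _ _

theorem mem_span_nullConeSequence_of_mul_mem (h : m + n ≤ p + 1)
    {D : Set ((Fin m × Fin n) ⊕ (Fin m ⊕ Fin n))} {c : (Fin m × Fin n) ⊕ (Fin m ⊕ Fin n)}
    (hc : c ∉ D) {g : MvPolynomial ((Fin (p + 1) × Fin m) ⊕ (Fin (p + 1) × Fin n)) ℂ}
    (hg : nullConeSequence p m n c * g ∈ Ideal.span (nullConeSequence p m n '' D)) :
    g ∈ Ideal.span (nullConeSequence p m n '' D) :=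
  mem_span_of_mul_mem_of_coprime_leadingMonomial (antidiagonalWeight p m n)
    (leadingExponent_ne_zero h) (leadingExponent_disjoint h)
    (hasLeadingMonomial_nullConeSequence h) hc hg

theorem span_nullConeSequence_inl (p m n : ℕ) :
    Ideal.span (nullConeSequence p m n '' Set.range Sum.inl) = nullConeIdealU (p + 1) m n := by
  rw [nullConeIdealU]
  congr 1
  ext f
  simp [nullConeSequence, eq_comm]

end Degeneration

namespace NullConeRing

theorem ringKrullDim_eq {p m n : ℕ} (h : m + n ≤ p + 1) :
    ringKrullDim (NullConeRing (p + 1) m n) =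
      (((p + 1) * (m + n) - m * n : ℕ) : WithBot (WithTop ℕ)) := by
  have hcard : Fintype.card ((Fin (p + 1) × Fin m) ⊕ (Fin (p + 1) × Fin n)) =
      (p + 1) * (m + n) := by simp [mul_add]
  have hmn : m * n ≤ (p + 1) * (m + n) := by nlinarith
  have himg : ∀ D : Set (Fin m × Fin n), (nullConeSequence p m n ∘ Sum.inl) '' D =
      nullConeSequence p m n '' (Sum.inl '' D) := fun D => Set.image_comp _ _ _
  have hspan : Ideal.span ((nullConeSequence p m n ∘ Sum.inl) ''
      ((Finset.univ : Finset (Fin m × Fin n)) : Set (Fin m × Fin n))) =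
      nullConeIdealU (p + 1) m n := by
    rw [himg, Finset.coe_univ, Set.image_univ, span_nullConeSequence_inl]
  have hle := ringKrullDim_quotient_span_image_add_card_le
    (f := nullConeSequence p m n ∘ Sum.inl) (fun D c hc g hg => by
      rw [himg] at hg ⊢
      exact mem_span_nullConeSequence_of_mul_mem h (by simpa using hc) hg) Finset.univ
  rw [hspan, MvPolynomial.ringKrullDim_of_isNoetherianRing, ringKrullDim_eq_zero_of_field,
    zero_add, Nat.card_eq_fintype_card, hcard, Finset.card_univ, Fintype.card_prod,
    Fintype.card_fin, Fintype.card_fin] at hle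
  have hge : (((p + 1) * (m + n) : ℕ) : WithBot ℕ∞) ≤
      ringKrullDim (NullConeRing (p + 1) m n) + (m * n : ℕ) := by
    have hprime : (RingHom.ker (constantCoeff : MvPolynomial
        ((Fin (p + 1) × Fin m) ⊕ (Fin (p + 1) × Fin n)) ℂ →+* ℂ)).IsPrime := RingHom.ker_isPrime _
    have h1 := card_le_height_ker_constantCoeff
      ((Fin (p + 1) × Fin m) ⊕ (Fin (p + 1) × Fin n)) ℂ
    rw [hcard] at h1
    have h2 := Ideal.height_le_ringKrullDim_quotient_add_encard
      (p := RingHom.ker (constantCoeff : MvPolynomial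
        ((Fin (p + 1) × Fin m) ⊕ (Fin (p + 1) × Fin n)) ℂ →+* ℂ))
      ((nullConeSequence p m n ∘ Sum.inl) ''
        ((Finset.univ : Finset (Fin m × Fin n)) : Set (Fin m × Fin n))) (by
          rintro _ ⟨c, -, rfl⟩
          simp [nullConeSequence, RingHom.mem_ker])
    rw [hspan] at h2
    have h3 : ((nullConeSequence p m n ∘ Sum.inl) ''
        ((Finset.univ : Finset (Fin m × Fin n)) : Set (Fin m × Fin n))).encard ≤ (m * n : ℕ) := by
      refine (Set.encard_image_le _ _).trans ?_
      simp [Set.encard_univ]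
    refine le_trans (WithBot.coe_le_coe.mpr h1) (h2.trans ?_)
    gcongr
    exact_mod_cast h3
  revert hle hge hmn
  generalize ringKrullDim (NullConeRing (p + 1) m n) = d
  generalize (p + 1) * (m + n) = N
  generalize m * n = M
  intro hmn hle hge
  induction d with
  | bot => exact absurd (hge.trans_eq (WithBot.bot_add _)) (not_le.mpr (WithBot.bot_lt_coe _))
  | coe d =>
    induction d with
    | top => exact absurd hle (not_le.mpr (WithBot.coe_lt_coe.mpr (ENat.natCast_lt_top N)))
    | coe d =>
      have h1 : d + M ≤ N := by exact_mod_cast hle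
      have h2 : N ≤ d + M := by exact_mod_cast hge
      obtain rfl : d = N - M := by omega
      rfl

theorem isDomain_and_isIntegrallyClosed_of_isEmpty {p m n : ℕ} (h : m = 0 ∨ n = 0) :
    IsDomain (NullConeRing p m n) ∧ IsIntegrallyClosed (NullConeRing p m n) := by
  have hbot : nullConeIdealU p m n = ⊥ := by
    rw [nullConeIdealU, Ideal.span_eq_bot]
    rintro _ ⟨i, j, -⟩
    rcases h with rfl | rfl
    · exact i.elim0
    · exact j.elim0
  let e : MvPolynomial ((Fin p × Fin m) ⊕ (Fin p × Fin n)) ℂ ≃+* NullConeRing p m n :=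
    (RingEquiv.quotientBot _).symm.trans (Ideal.quotEquivOfEq hbot.symm)
  exact ⟨e.symm.toMulEquiv.isDomain _, .of_equiv e⟩

theorem isDomain_and_isIntegrallyClosed_of_equiv_away {P S : Type*} [CommRing P] [IsDomain P]
    [IsIntegrallyClosed P] [CommRing S] {x : P} (hx : x ≠ 0) (e : S ≃+* Localization.Away x) :
    IsDomain S ∧ IsIntegrallyClosed S := by
  have hle : Submonoid.powers x ≤ nonZeroDivisors P :=
    Submonoid.powers_le.mpr (mem_nonZeroDivisors_of_ne_zero hx)
  have : IsDomain (Localization.Away x) := IsLocalization.isDomain_localization hle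
  have : IsIntegrallyClosed (Localization.Away x) :=
    isIntegrallyClosed_of_isLocalization _ (Submonoid.powers x) hle
  exact ⟨e.toMulEquiv.isDomain _, .of_equiv e.symm⟩

theorem isDomain_and_isIntegrallyClosed_away {p m n : ℕ} [IsDomain (NullConeRing p m n)]
    [IsIntegrallyClosed (NullConeRing p m n)] :
    IsDomain (Away p m n) ∧ IsIntegrallyClosed (Away p m n) := by
  have : IsIntegrallyClosed (PivotPoly p m n) := MvPolynomial.isIntegrallyClosed _ _
  exact isDomain_and_isIntegrallyClosed_of_equiv_away (X_ne_zero _) (awayEquiv p m n).toRingEquiv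

theorem isDomain_and_isIntegrallyClosed : ∀ {p m n : ℕ}, m + n ≤ p →
    IsDomain (NullConeRing p m n) ∧ IsIntegrallyClosed (NullConeRing p m n)
  | _, 0, _, _ => isDomain_and_isIntegrallyClosed_of_isEmpty (.inl rfl)
  | _, _ + 1, 0, _ => isDomain_and_isIntegrallyClosed_of_isEmpty (.inr rfl)
  | p + 1, m + 1, n + 1, h => by
    obtain ⟨_, _⟩ := isDomain_and_isIntegrallyClosed (p := p) (m := m) (n := n + 1) (by omega)
    obtain ⟨_, _⟩ := isDomain_and_isIntegrallyClosed (p := p) (m := n) (n := m + 1) (by omega)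
    obtain ⟨_, _⟩ := isDomain_and_isIntegrallyClosed_away (p := p) (m := m) (n := n + 1)
    obtain ⟨_, hB⟩ := isDomain_and_isIntegrallyClosed_away (p := p) (m := n) (n := m + 1)
    let x : NullConeRing (p + 1) (m + 1) (n + 1) := a (Fin.last p) 0
    let y : NullConeRing (p + 1) (m + 1) (n + 1) := b (Fin.last p) 0
    let e : Localization.Away y ≃+* Away p n (m + 1) :=
      IsLocalization.ringEquivOfRingEquiv (M := Submonoid.powers y)
        (T := Submonoid.powers (a (Fin.last p) 0 : NullConeRing (p + 1) (n + 1) (m + 1))) _ _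
        (swap (p + 1) (m + 1) (n + 1)).toRingEquiv <| by
          rw [Submonoid.map_powers]
          exact congrArg Submonoid.powers (swap_b (Fin.last p) 0)
    have : IsIntegrallyClosed (Localization.Away y) := .of_equiv e.symm
    have hreg : ∀ (c : Fin (m + 1) ⊕ Fin (n + 1)), Ideal.Quotient.mk
        (nullConeIdealU (p + 1) (m + 1) (n + 1)) (nullConeSequence p (m + 1) (n + 1) (Sum.inr c)) ∈
        nonZeroDivisors (NullConeRing (p + 1) (m + 1) (n + 1)) := fun c => by
      rw [mem_nonZeroDivisors_iff_left]
      intro z hz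
      obtain ⟨g, rfl⟩ := Ideal.Quotient.mk_surjective z
      rw [← map_mul, Ideal.Quotient.eq_zero_iff_mem, ← span_nullConeSequence_inl] at hz
      rw [Ideal.Quotient.eq_zero_iff_mem, ← span_nullConeSequence_inl]
      exact mem_span_nullConeSequence_of_mul_mem h (by simp) hz
    refine isDomain_and_isIntegrallyClosed_of_away (x := x) (y := y) (B := Away p m (n + 1))
      (C := Localization.Away y) (hreg (Sum.inl 0)) (hreg (Sum.inr 0)) fun z hz => ?_
    obtain ⟨g, rfl⟩ := Ideal.Quotient.mk_surjective z
    have hmem : ∀ g', x ∣ Ideal.Quotient.mk _ g' ↔ g' ∈ Ideal.span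
        (nullConeSequence p (m + 1) (n + 1) ''
          insert (Sum.inr (Sum.inl 0)) (Set.range Sum.inl)) := fun g' => by
      rw [Set.image_insert_eq, Ideal.mem_span_insert, span_nullConeSequence_inl]
      constructor
      · rintro ⟨q, hq⟩
        obtain ⟨q, rfl⟩ := Ideal.Quotient.mk_surjective q
        refine ⟨q, g' - q * X (Sum.inl (Fin.last p, 0)), ?_, by simp [nullConeSequence]⟩
        rw [← Ideal.Quotient.eq, hq, map_mul, mul_comm]
        rfl
      · rintro ⟨q, r, hr, rfl⟩
        rw [map_add, map_mul, Ideal.Quotient.eq_zero_iff_mem.mpr hr, add_zero]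
        exact dvd_mul_left _ _
    rw [hmem]
    refine mem_span_nullConeSequence_of_mul_mem (c := Sum.inr (Sum.inr 0)) h (by simp) ?_
    rw [← hmem, map_mul]
    exact hz

end NullConeRing

/-- In the stable range `m + n ≤ p`, the ideal of the null cone
`{(A,B) : AᵀB = 0}` is prime, its quotient ring is an integrally closed integral
domain of Krull dimension `p(m+n) - mn`; i.e. the null cone is an irreducible
normal variety which is a set-theoretic complete intersection of codimension `mn`. -/
theorem nullConeU_prime_normal_dim (p m n : ℕ) (hp : 0 < p) (hm : 0 < m) (hn : 0 < n)
    (h : m + n ≤ p) :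
    (nullConeIdealU p m n).IsPrime ∧
      IsDomain (MvPolynomial ((Fin p × Fin m) ⊕ (Fin p × Fin n)) ℂ ⧸
        nullConeIdealU p m n) ∧
      IsIntegrallyClosed (MvPolynomial ((Fin p × Fin m) ⊕ (Fin p × Fin n)) ℂ ⧸
        nullConeIdealU p m n) ∧
      ringKrullDim (MvPolynomial ((Fin p × Fin m) ⊕ (Fin p × Fin n)) ℂ ⧸
          nullConeIdealU p m n) =
        ((p * (m + n) - m * n : ℕ) : WithBot (WithTop ℕ)) := by
  obtain ⟨p, rfl⟩ := Nat.exists_eq_succ_of_ne_zero hp.ne'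
  obtain ⟨h1, h2⟩ := NullConeRing.isDomain_and_isIntegrallyClosed h
  exact ⟨(Ideal.Quotient.isDomain_iff_prime _).mp h1, h1, h2, NullConeRing.ringKrullDim_eq h⟩
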